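/- With D and ψ^D as above, the functions ψ^D_{k,m}(x₁,x₂) = 2^{-k/2} ψ^D((x₁ - 2^k m)/2^k, x₂), k, m ∈ ℤ, are pairwise orthonormal in L²(ℝ²): ⟨ψ^D_{k,m}, ψ^D_{k',m'}⟩ = δ_{k,k'} δ_{m,m'}. -/

import Mathlib

open MeasureTheory Complex Set

/-- `f_m(s) = χ_{(2^{-m-1},2^{-m}]}(|s|)`. -/
noncomputable def fm (m : ℕ) (s : ℝ) : ℝ :=
  if |s| ∈ Set.Ioc ((2:ℝ) ^ (-(m:ℤ) - 1)) ((2:ℝ) ^ (-(m:ℤ))) then 1 else 0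

/-- `e_{k,l}(y) = χ_{(k,k+1]}(y) e^{2πily}`. -/
noncomputable def ee (k l : ℤ) (y : ℝ) : ℂ :=
  if y ∈ Set.Ioc (k : ℝ) (k + 1) then Complex.exp (2 * Real.pi * Complex.I * l * y) else 0

/-- The partial Fourier transform `ψ^D(ŝ,y) = Σ_{k,l} f_{D(k,l)}(s) e_{k,l}(y)`. -/
noncomputable def PhiD (D : ℤ × ℤ → ℕ) (p : ℝ × ℝ) : ℂ :=
  ∑' kl : ℤ × ℤ, (fm (D kl) p.1 : ℂ) * ee kl.1 kl.2 p.2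

/-- `ψ^D`, recovered from its partial Fourier transform in the first variable by
Fourier inversion (for each fixed `y`, `ψ^D(ŝ,y)` is integrable in `s`). -/
noncomputable def psiD (D : ℤ × ℤ → ℕ) (p : ℝ × ℝ) : ℂ :=
  ∫ s : ℝ, PhiD D (s, p.2) * Complex.exp (2 * Real.pi * Complex.I * s * p.1)

/-- The system `ψ^D_{k,m}(x₁,x₂) = 2^{-k/2} ψ^D((x₁-2^k m)/2^k, x₂)`. -/
noncomputable def psiDkm (D : ℤ × ℤ → ℕ) (k m : ℤ) (p : ℝ × ℝ) : ℂ :=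
  (Real.sqrt ((2:ℝ) ^ k))⁻¹ * psiD D ((p.1 - (2:ℝ) ^ k * m) / (2:ℝ) ^ k, p.2)

open scoped FourierTransform in
/-- The pointwise Fourier transform of a function in `L¹ ∩ L²` represents its `L²` Fourier
transform. -/
theorem fourier_ae_eq_fourier_toLp {g : ℝ → ℂ} (h1 : Integrable g) (h2 : MemLp g 2) :
    𝓕 g =ᵐ[volume] (𝓕 (h2.toLp g) : Lp ℂ 2 (volume : Measure ℝ)) := by
  have hcont : Continuous (𝓕 g) :=
    VectorFourier.fourierIntegral_continuous Real.continuous_fourierChar continuous_inner h1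
  refine ae_eq_of_integral_contDiff_smul_eq hcont.locallyIntegrable
    ((Lp.memLp _).locallyIntegrable (by norm_num)) fun φ hφ hφc => ?_
  have hc : HasCompactSupport (Complex.ofRealCLM ∘ φ) := hφc.comp_left rfl
  have hs : ContDiff ℝ (⊤ : ℕ∞) (Complex.ofRealCLM ∘ φ) := by fun_prop
  set Φ : SchwartzMap ℝ ℂ := hc.toSchwartzMap hs with hΦ
  have hΦφ : ∀ x, Φ x = φ x := fun x => rfl
  have hL : ∫ x, Φ x • (𝓕 (h2.toLp g) : Lp ℂ 2 (volume : Measure ℝ)) x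
      = ∫ x, (𝓕 Φ) x • (h2.toLp g) x := by
    have := congrArg (fun T => T Φ) (Lp.fourier_toTemperedDistribution_eq (h2.toLp g))
    simp only [TemperedDistribution.fourier_apply, Lp.toTemperedDistribution_apply] at this
    exact this.symm
  have hR : ∫ x, (𝓕 (Φ : ℝ → ℂ)) x • g x = ∫ x, Φ x • (𝓕 g) x := by
    have := VectorFourier.integral_fourierIntegral_smul_eq_flip (L := innerₗ ℝ) (μ := volume)
      (ν := volume) Real.continuous_fourierChar continuous_inner Φ.integrable h1
    rwa [flip_innerₗ] at this
  have hM : ∫ x, (𝓕 Φ) x • (h2.toLp g) x = ∫ x, (𝓕 (Φ : ℝ → ℂ)) x • g x := by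
    refine integral_congr_ae ?_
    filter_upwards [h2.coeFn_toLp] with x hx
    rw [hx, SchwartzMap.fourier_coe]
  have := hR.symm.trans (hM.symm.trans hL.symm)
  simpa only [hΦφ, Complex.real_smul, smul_eq_mul] using this

open scoped FourierTransform in
theorem memLp_fourier {g : ℝ → ℂ} (h1 : Integrable g) (h2 : MemLp g 2) : MemLp (𝓕 g) 2 :=
  (memLp_congr_ae (fourier_ae_eq_fourier_toLp h1 h2)).2 (Lp.memLp _)

open scoped FourierTransform in
/-- Plancherel's theorem for the pointwise Fourier transform on `L¹ ∩ L²`. -/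
theorem integral_fourier_mul_conj_fourier {g h : ℝ → ℂ} (g1 : Integrable g) (g2 : MemLp g 2)
    (h1 : Integrable h) (h2 : MemLp h 2) :
    ∫ x, 𝓕 g x * (starRingEnd ℂ) (𝓕 h x) = ∫ s, g s * (starRingEnd ℂ) (h s) := by
  have := Lp.inner_fourier_eq (h2.toLp h) (g2.toLp g)
  rw [L2.inner_def, L2.inner_def] at this
  convert this using 1 <;> refine integral_congr_ae ?_
  · filter_upwards [fourier_ae_eq_fourier_toLp g1 g2, fourier_ae_eq_fourier_toLp h1 h2]
      with x hx hy
    rw [hx, hy]; rfl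
  · filter_upwards [g2.coeFn_toLp, h2.coeFn_toLp] with x hx hy
    rw [hx, hy]; rfl

open scoped FourierTransform in
theorem memLp_fourierInv {g : ℝ → ℂ} (h1 : Integrable g) (h2 : MemLp g 2) :
    MemLp (𝓕⁻ g) 2 := by
  have : 𝓕⁻ g = 𝓕 g ∘ Neg.neg := funext fun x => Real.fourierInv_eq_fourier_neg g x
  rw [this]
  exact (memLp_fourier h1 h2).comp_measurePreserving (Measure.measurePreserving_neg volume)

open scoped FourierTransform in
theorem integral_fourierInv_mul_conj_fourierInv {g h : ℝ → ℂ} (g1 : Integrable g)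
    (g2 : MemLp g 2) (h1 : Integrable h) (h2 : MemLp h 2) :
    ∫ x, 𝓕⁻ g x * (starRingEnd ℂ) (𝓕⁻ h x) = ∫ s, g s * (starRingEnd ℂ) (h s) := by
  rw [← integral_fourier_mul_conj_fourier g1 g2 h1 h2,
    ← integral_neg_eq_self (fun x => 𝓕 g x * (starRingEnd ℂ) (𝓕 h x))]
  simp only [Real.fourierInv_eq_fourier_neg]

open scoped FourierTransform in
theorem integral_norm_sq_fourierInv {g : ℝ → ℂ} (g1 : Integrable g) (g2 : MemLp g 2) :
    ∫ x, ‖𝓕⁻ g x‖ ^ 2 = ∫ s, ‖g s‖ ^ 2 := by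
  have := integral_fourierInv_mul_conj_fourierInv g1 g2 g1 g2
  simp only [Complex.mul_conj, Complex.normSq_eq_norm_sq] at this
  rw [integral_complex_ofReal, integral_complex_ofReal] at this
  exact_mod_cast this

open scoped FourierTransform in
theorem stronglyMeasurable_fourierInv_fst {G : ℝ × ℝ → ℂ} (hG : Measurable G) :
    StronglyMeasurable fun p : ℝ × ℝ => 𝓕⁻ (fun s => G (s, p.2)) p.1 := by
  simp only [Real.fourierInv_eq']
  have : Measurable fun q : (ℝ × ℝ) × ℝ =>
      Complex.exp (↑(2 * Real.pi * inner ℝ q.2 q.1.1) * I) • G (q.2, q.1.2) := by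
    fun_prop
  exact this.stronglyMeasurable.integral_prod_right'

open scoped FourierTransform in
theorem memLp_fourierInv_fst {G : ℝ × ℝ → ℂ} (hG : Measurable G)
    (G1 : ∀ y, Integrable fun s => G (s, y)) (G2 : ∀ y, MemLp (fun s => G (s, y)) 2)
    (hL : MemLp G 2) :
    MemLp (fun p : ℝ × ℝ => 𝓕⁻ (fun s => G (s, p.2)) p.1) 2 := by
  have hm := stronglyMeasurable_fourierInv_fst hG
  have hm2 : StronglyMeasurable fun p : ℝ × ℝ => ‖𝓕⁻ (fun s => G (s, p.2)) p.1‖ ^ 2 :=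
    hm.norm.pow 2
  rw [memLp_two_iff_integrable_sq_norm hm.aestronglyMeasurable, Measure.volume_eq_prod,
    integrable_prod_iff' hm2.aestronglyMeasurable]
  rw [memLp_two_iff_integrable_sq_norm hL.1, Measure.volume_eq_prod,
    integrable_prod_iff' (by fun_prop)] at hL
  refine ⟨.of_forall fun y => ?_, ?_⟩
  · exact (memLp_two_iff_integrable_sq_norm (memLp_fourierInv (G1 y) (G2 y)).1).1
      (memLp_fourierInv (G1 y) (G2 y))
  · have h := hL.2
    simp only [norm_pow, norm_norm] at h ⊢
    exact h.congr (.of_forall fun y => (integral_norm_sq_fourierInv (G1 y) (G2 y)).symm)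

theorem integrable_mul_conj {X : Type*} [MeasurableSpace X] {μ : Measure X} {f g : X → ℂ}
    (hf : MemLp f 2 μ) (hg : MemLp g 2 μ) :
    Integrable (fun x => f x * (starRingEnd ℂ) (g x)) μ :=
  hf.integrable_mul hg.star

open scoped FourierTransform in
/-- Plancherel's theorem for the partial Fourier transform in the first variable. -/
theorem integral_fourierInv_fst_mul_conj {G H : ℝ × ℝ → ℂ}
    (hG : Measurable G) (G1 : ∀ y, Integrable fun s => G (s, y))
    (G2 : ∀ y, MemLp (fun s => G (s, y)) 2) (hGL : MemLp G 2)
    (hH : Measurable H) (H1 : ∀ y, Integrable fun s => H (s, y))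
    (H2 : ∀ y, MemLp (fun s => H (s, y)) 2) (hHL : MemLp H 2) :
    ∫ p : ℝ × ℝ, 𝓕⁻ (fun s => G (s, p.2)) p.1 *
        (starRingEnd ℂ) (𝓕⁻ (fun s => H (s, p.2)) p.1) =
      ∫ s, ∫ y, G (s, y) * (starRingEnd ℂ) (H (s, y)) := by
  have hK := integrable_mul_conj (memLp_fourierInv_fst hG G1 G2 hGL)
    (memLp_fourierInv_fst hH H1 H2 hHL)
  have hI := integrable_mul_conj hGL hHL
  rw [Measure.volume_eq_prod] at hK hI ⊢
  rw [integral_integral_swap hI, integral_prod_symm _ hK]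
  congr 1
  ext y
  exact integral_fourierInv_mul_conj_fourierInv (G1 y) (G2 y) (H1 y) (H2 y)

theorem eq_of_mem_Ioc_two_zpow {t : ℝ} {a b : ℤ} (ha : t ∈ Ioc ((2:ℝ) ^ (a - 1)) ((2:ℝ) ^ a))
    (hb : t ∈ Ioc ((2:ℝ) ^ (b - 1)) ((2:ℝ) ^ b)) : a = b := by
  have h1 := (zpow_lt_zpow_iff_right₀ (one_lt_two (α := ℝ))).1 (ha.1.trans_le hb.2)
  have h2 := (zpow_lt_zpow_iff_right₀ (one_lt_two (α := ℝ))).1 (hb.1.trans_le ha.2)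
  omega

theorem measurable_fm (m : ℕ) : Measurable (fm m) :=
  Measurable.ite (measurableSet_Ioc.preimage measurable_norm) measurable_const measurable_const

theorem measurable_ee (k l : ℤ) : Measurable (ee k l) :=
  Measurable.ite measurableSet_Ioc (by fun_prop) measurable_const

theorem norm_ee_le (k l : ℤ) (y : ℝ) : ‖ee k l y‖ ≤ 1 := by
  unfold ee
  split_ifs
  · rw [Complex.norm_exp]; simp
  · simp

theorem measurable_PhiD (D : ℤ × ℤ → ℕ) : Measurable (PhiD D) := by
  refine Measurable.tsum fun κ => ?_
  have := measurable_fm (D κ)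
  have := measurable_ee κ.1 κ.2
  fun_prop

/-- A bounded measurable function with bounded support is in every `Lᵖ`. -/
theorem memLp_of_bounded_of_support {f : ℝ → ℂ} (hf : Measurable f) {a b C : ℝ}
    (hC : ∀ x, ‖f x‖ ≤ C) (h0 : ∀ x ∉ Icc a b, f x = 0) (p : ENNReal) : MemLp f p := by
  have : f = (Icc a b).indicator f := (indicator_eq_self.2 fun x hx => by
    by_contra h; exact hx (h0 x h)).symm
  rw [this, memLp_indicator_iff_restrict measurableSet_Icc]
  exact MemLp.of_bound hf.aestronglyMeasurable C (.of_forall hC)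

theorem memLp_ee (k l : ℤ) (p : ENNReal) : MemLp (ee k l) p :=
  memLp_of_bounded_of_support (measurable_ee k l) (norm_ee_le k l)
    (fun _ hx => if_neg fun h => hx (Ioc_subset_Icc_self h)) p

theorem integral_exp_two_pi_int (n : ℤ) (a : ℝ) :
    ∫ y in Ioc a (a + 1), Complex.exp (2 * Real.pi * Complex.I * n * y) =
      if n = 0 then 1 else 0 := by
  rw [← intervalIntegral.integral_of_le (by linarith)]
  split_ifs with h
  · simp [h]
  · rw [integral_exp_mul_complex (by simp [h, Real.pi_ne_zero])]
    have : (2 * Real.pi * Complex.I * n : ℂ) * ((a + 1 : ℝ) : ℂ) =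
        2 * Real.pi * Complex.I * n * a + n * (2 * Real.pi * Complex.I) := by
      push_cast; ring
    rw [this, Complex.exp_add, Complex.exp_int_mul_two_pi_mul_I]
    simp

theorem exp_mul_conj_exp (l l' : ℤ) (y : ℝ) :
    Complex.exp (2 * Real.pi * Complex.I * l * y) *
      (starRingEnd ℂ) (Complex.exp (2 * Real.pi * Complex.I * l' * y)) =
    Complex.exp (2 * Real.pi * Complex.I * (l - l' : ℤ) * y) := by
  rw [← Complex.exp_conj, ← Complex.exp_add]
  congr 1
  simp only [map_mul, map_ofNat, Complex.conj_ofReal, Complex.conj_I, map_intCast]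
  push_cast
  ring

theorem integral_ee_mul_conj_ee (κ κ' : ℤ × ℤ) :
    ∫ y, ee κ.1 κ.2 y * (starRingEnd ℂ) (ee κ'.1 κ'.2 y) = if κ = κ' then 1 else 0 := by
  obtain ⟨k, l⟩ := κ
  obtain ⟨k', l'⟩ := κ'
  by_cases hk : k = k'
  · subst hk
    have : ∀ y, ee k l y * (starRingEnd ℂ) (ee k l' y) = (Ioc (k : ℝ) (k + 1)).indicator
        (fun y : ℝ => Complex.exp (2 * Real.pi * Complex.I * (l - l' : ℤ) * y)) y := by
      intro y
      simp only [← exp_mul_conj_exp]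
      by_cases hy : y ∈ Ioc (k : ℝ) (k + 1) <;> simp only [ee, hy, indicator, if_true, if_false]
      simp
    simp only [this]
    rw [integral_indicator measurableSet_Ioc, integral_exp_two_pi_int]
    simp [sub_eq_zero]
  · have : ∀ y, ee k l y * (starRingEnd ℂ) (ee k' l' y) = 0 := by
      intro y
      by_cases hy : y ∈ Ioc (k : ℝ) (k + 1)
      · have hy' : y ∉ Ioc (k' : ℝ) (k' + 1) := by
          intro hy'
          have h1 : (k : ℝ) < k' + 1 := hy.1.trans_le hy'.2
          have h2 : (k' : ℝ) < k + 1 := hy'.1.trans_le hy.2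
          norm_cast at h1 h2
          omega
        simp [ee, hy']
      · simp [ee, hy]
    simp [this, hk]

variable {D : ℤ × ℤ → ℕ}

theorem fm_eq_one_unique {m n : ℕ} {u : ℝ} (hm : fm m u = 1) (hn : fm n u = 1) : m = n := by
  simp only [fm, ite_eq_left_iff, zero_ne_one, imp_false, not_not] at hm hn
  have := eq_of_mem_Ioc_two_zpow hm hn
  omega

theorem fm_eq_zero_or_one (m : ℕ) (u : ℝ) : fm m u = 0 ∨ fm m u = 1 := by
  unfold fm; split_ifs <;> simp

theorem PhiD_of_fm_eq_one (hD : BijOn D univ {n : ℕ | 1 ≤ n}) {κ : ℤ × ℤ} {u : ℝ}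
    (h : fm (D κ) u = 1) (y : ℝ) : PhiD D (u, y) = ee κ.1 κ.2 y := by
  unfold PhiD
  rw [tsum_eq_single κ]
  · simp [h]
  · intro κ' hne
    rcases fm_eq_zero_or_one (D κ') u with h0 | h1
    · simp [h0]
    · exact absurd (hD.injOn (mem_univ _) (mem_univ _) (fm_eq_one_unique h1 h)) hne

theorem exists_fm_eq_one (hD : BijOn D univ {n : ℕ | 1 ≤ n}) {u : ℝ} (h0 : u ≠ 0)
    (h1 : |u| ≤ 1 / 2) : ∃ κ, fm (D κ) u = 1 := by
  obtain ⟨n, hn⟩ := exists_mem_Ioc_zpow (abs_pos.2 h0) (one_lt_two (α := ℝ))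
  have hn1 : n < -1 := by
    refine (zpow_lt_zpow_iff_right₀ (one_lt_two (α := ℝ))).1 (hn.1.trans_le (h1.trans ?_))
    norm_num
  obtain ⟨κ, -, hκ⟩ := hD.surjOn (show (-n - 1).toNat ∈ {n : ℕ | 1 ≤ n} by
    simp only [mem_ofPred_eq]; omega)
  refine ⟨κ, if_pos ?_⟩
  have e : -((D κ : ℕ) : ℤ) = n + 1 := by rw [hκ]; omega
  rw [e, add_sub_cancel_right]
  exact hn

theorem support_of_fm_eq_one (hD : BijOn D univ {n : ℕ | 1 ≤ n}) {κ : ℤ × ℤ} {u : ℝ}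
    (h : fm (D κ) u = 1) : u ≠ 0 ∧ |u| ≤ 1 / 2 := by
  simp only [fm, ite_eq_left_iff, zero_ne_one, imp_false, not_not] at h
  refine ⟨abs_pos.1 (lt_trans (by positivity) h.1), h.2.trans ?_⟩
  have h1 : 1 ≤ D κ := hD.mapsTo (mem_univ κ)
  calc (2:ℝ) ^ (-(D κ : ℤ)) ≤ 2 ^ (-1 : ℤ) := zpow_le_zpow_right₀ one_le_two (by omega)
    _ = 1 / 2 := by norm_num

theorem PhiD_eq_zero (hD : BijOn D univ {n : ℕ | 1 ≤ n}) {u : ℝ}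
    (h : ¬(u ≠ 0 ∧ |u| ≤ 1 / 2)) (y : ℝ) : PhiD D (u, y) = 0 := by
  have : ∀ κ, fm (D κ) u = 0 := fun κ =>
    (fm_eq_zero_or_one (D κ) u).resolve_right fun h1 => h (support_of_fm_eq_one hD h1)
  simp [PhiD, this]

theorem norm_PhiD_le (hD : BijOn D univ {n : ℕ | 1 ≤ n}) (u y : ℝ) : ‖PhiD D (u, y)‖ ≤ 1 := by
  by_cases h : u ≠ 0 ∧ |u| ≤ 1 / 2
  · obtain ⟨κ, hκ⟩ := exists_fm_eq_one hD h.1 h.2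
    rw [PhiD_of_fm_eq_one hD hκ]
    exact norm_ee_le _ _ _
  · simp [PhiD_eq_zero hD h]

theorem memLp_PhiD (hD : BijOn D univ {n : ℕ | 1 ≤ n}) (u : ℝ) (p : ENNReal) :
    MemLp (fun y => PhiD D (u, y)) p := by
  by_cases h : u ≠ 0 ∧ |u| ≤ 1 / 2
  · obtain ⟨κ, hκ⟩ := exists_fm_eq_one hD h.1 h.2
    simp only [PhiD_of_fm_eq_one hD hκ]
    exact memLp_ee _ _ _
  · simp [PhiD_eq_zero hD h]

open scoped Classical in
theorem integral_PhiD_mul_conj_self (hD : BijOn D univ {n : ℕ | 1 ≤ n}) (u : ℝ) :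
    ∫ y, PhiD D (u, y) * (starRingEnd ℂ) (PhiD D (u, y)) =
      if u ≠ 0 ∧ |u| ≤ 1 / 2 then 1 else 0 := by
  split_ifs with h
  · obtain ⟨κ, hκ⟩ := exists_fm_eq_one hD h.1 h.2
    simp only [PhiD_of_fm_eq_one hD hκ]
    simpa using integral_ee_mul_conj_ee κ κ
  · simp [PhiD_eq_zero hD h]

theorem integral_PhiD_mul_conj_of_ne (hD : BijOn D univ {n : ℕ | 1 ≤ n}) {k k' : ℤ}
    (hk : k ≠ k') (s : ℝ) :
    ∫ y, PhiD D (2 ^ k * s, y) * (starRingEnd ℂ) (PhiD D (2 ^ k' * s, y)) = 0 := by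
  by_cases h : (2 : ℝ) ^ k * s ≠ 0 ∧ |(2 : ℝ) ^ k * s| ≤ 1 / 2
  swap
  · simp [PhiD_eq_zero hD h]
  by_cases h' : (2 : ℝ) ^ k' * s ≠ 0 ∧ |(2 : ℝ) ^ k' * s| ≤ 1 / 2
  swap
  · simp [PhiD_eq_zero hD h']
  obtain ⟨κ, hκ⟩ := exists_fm_eq_one hD h.1 h.2
  obtain ⟨κ', hκ'⟩ := exists_fm_eq_one hD h'.1 h'.2
  simp only [PhiD_of_fm_eq_one hD hκ, PhiD_of_fm_eq_one hD hκ']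
  rw [integral_ee_mul_conj_ee, if_neg]
  rintro rfl
  simp only [fm, ite_eq_left_iff, zero_ne_one, imp_false, not_not] at hκ hκ'
  have scale : ∀ j : ℤ, |(2:ℝ) ^ j * s| ∈ Ioc ((2:ℝ) ^ (-(D κ : ℤ) - 1)) (2 ^ (-(D κ : ℤ))) →
      |s| ∈ Ioc ((2:ℝ) ^ (-(D κ : ℤ) - j - 1)) (2 ^ (-(D κ : ℤ) - j)) := by
    intro j hj
    have hp : (0:ℝ) < 2 ^ j := by positivity
    rw [abs_mul, abs_of_pos hp] at hj
    rw [sub_right_comm, zpow_sub₀ two_ne_zero (-(D κ : ℤ) - 1), zpow_sub₀ two_ne_zero _ j]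
    exact ⟨(div_lt_iff₀' hp).2 hj.1, (le_div_iff₀' hp).2 hj.2⟩
  have := eq_of_mem_Ioc_two_zpow (scale k hκ) (scale k' hκ')
  omega

/-- The partial Fourier transform of `psiDkm D k m` in the first variable. -/
noncomputable def psiDkmHat (D : ℤ × ℤ → ℕ) (k m : ℤ) (p : ℝ × ℝ) : ℂ :=
  (Real.sqrt ((2:ℝ) ^ k) : ℂ) * Complex.exp (2 * Real.pi * Complex.I * (-m : ℤ) *
    ((2:ℝ) ^ k * p.1 : ℝ)) * PhiD D ((2:ℝ) ^ k * p.1, p.2)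

open scoped FourierTransform in
theorem psiDkm_eq_fourierInv (D : ℤ × ℤ → ℕ) (k m : ℤ) (p : ℝ × ℝ) :
    psiDkm D k m p = 𝓕⁻ (fun s => psiDkmHat D k m (s, p.2)) p.1 := by
  obtain ⟨x, y⟩ := p
  simp only [psiDkm, psiD, Real.fourierInv_eq', psiDkmHat]
  have ha : (0:ℝ) < 2 ^ k := by positivity
  generalize (2:ℝ) ^ k = a at ha ⊢
  have haC : (a : ℂ) ≠ 0 := by exact_mod_cast ha.ne'
  have key := Measure.integral_comp_mul_left (fun u : ℝ => (Real.sqrt a : ℂ) * (PhiD D (u, y) *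
    Complex.exp (2 * Real.pi * Complex.I * u * ((x - a * m) / a : ℝ)))) a
  have hL : ∀ s : ℝ, Complex.exp (↑(2 * Real.pi * inner ℝ s x) * Complex.I) •
      ((Real.sqrt a : ℂ) * Complex.exp (2 * Real.pi * Complex.I * (-m : ℤ) * (a * s : ℝ)) *
        PhiD D (a * s, y)) = (Real.sqrt a : ℂ) * (PhiD D (a * s, y) *
    Complex.exp (2 * Real.pi * Complex.I * (a * s : ℝ) * ((x - a * m) / a : ℝ))) := by
    intro s
    have : Complex.exp (2 * Real.pi * Complex.I * (a * s : ℝ) * ((x - a * m) / a : ℝ)) =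
        Complex.exp (↑(2 * Real.pi * inner ℝ s x) * Complex.I) *
        Complex.exp (2 * Real.pi * Complex.I * (-m : ℤ) * (a * s : ℝ)) := by
      rw [← Complex.exp_add]
      congr 1
      simp only [Real.inner_apply]
      push_cast
      field_simp
      ring
    rw [this, smul_eq_mul]
    ring
  simp only [hL]
  rw [key, integral_const_mul, abs_of_pos (inv_pos.2 ha), Complex.real_smul, ← mul_assoc]
  congr 1
  have hs : (Real.sqrt a : ℂ) * Real.sqrt a = a := by
    exact_mod_cast Real.mul_self_sqrt ha.le
  have hs0 : (Real.sqrt a : ℂ) ≠ 0 := by exact_mod_cast (Real.sqrt_pos.2 ha).ne'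
  push_cast
  field_simp
  rw [sq, hs]

theorem measurable_psiDkmHat (D : ℤ × ℤ → ℕ) (k m : ℤ) : Measurable (psiDkmHat D k m) := by
  unfold psiDkmHat
  have := measurable_PhiD D
  fun_prop

theorem norm_exp_two_pi_I_int (n : ℤ) (t : ℝ) :
    ‖Complex.exp (2 * Real.pi * Complex.I * n * t)‖ = 1 := by
  rw [Complex.norm_exp]; simp

theorem memLp_psiDkmHat_fst (hD : BijOn D univ {n : ℕ | 1 ≤ n}) (k m : ℤ) (y : ℝ)
    (p : ENNReal) : MemLp (fun s => psiDkmHat D k m (s, y)) p := by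
  have ha : (0:ℝ) < 2 ^ k := by positivity
  have hm : Measurable fun s => psiDkmHat D k m (s, y) :=
    (measurable_psiDkmHat D k m).comp (by fun_prop)
  refine memLp_of_bounded_of_support (a := -(1 / 2 / 2 ^ k)) (b := 1 / 2 / 2 ^ k)
    (C := Real.sqrt (2 ^ k)) hm (fun s => ?_) (fun s hs => ?_) p
  · simp only [psiDkmHat]
    rw [norm_mul, norm_mul, norm_exp_two_pi_I_int, Complex.norm_real, mul_one,
      Real.norm_of_nonneg (Real.sqrt_nonneg _)]
    exact mul_le_of_le_one_right (Real.sqrt_nonneg _) (norm_PhiD_le hD _ _)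
  · simp only [psiDkmHat]
    rw [PhiD_eq_zero hD, mul_zero]
    rintro ⟨-, h⟩
    rw [abs_mul, abs_of_pos ha, ← le_div_iff₀' ha] at h
    exact hs (abs_le.1 h)

theorem integral_psiDkmHat_mul_conj (D : ℤ × ℤ → ℕ) (k m k' m' : ℤ) (s : ℝ) :
    ∫ y, psiDkmHat D k m (s, y) * (starRingEnd ℂ) (psiDkmHat D k' m' (s, y)) =
      ((Real.sqrt ((2:ℝ) ^ k) : ℂ) *
          Complex.exp (2 * Real.pi * Complex.I * (-m : ℤ) * ((2:ℝ) ^ k * s : ℝ))) *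
        (starRingEnd ℂ) ((Real.sqrt ((2:ℝ) ^ k') : ℂ) *
          Complex.exp (2 * Real.pi * Complex.I * (-m' : ℤ) * ((2:ℝ) ^ k' * s : ℝ))) *
        ∫ y, PhiD D (2 ^ k * s, y) * (starRingEnd ℂ) (PhiD D (2 ^ k' * s, y)) := by
  rw [← integral_const_mul]
  congr 1
  ext y
  simp only [psiDkmHat, map_mul]
  ring

open scoped Classical in
theorem integral_psiDkmHat_mul_conj_of_eq (hD : BijOn D univ {n : ℕ | 1 ≤ n}) (k m m' : ℤ)
    (s : ℝ) :
    ∫ y, psiDkmHat D k m (s, y) * (starRingEnd ℂ) (psiDkmHat D k m' (s, y)) =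
      ((2:ℝ) ^ k : ℝ) * {u : ℝ | u ≠ 0 ∧ |u| ≤ 1 / 2}.indicator
        (fun u : ℝ => Complex.exp (2 * Real.pi * Complex.I * (m' - m : ℤ) * u)) (2 ^ k * s) := by
  have hs : (Real.sqrt (2 ^ k) : ℂ) * Real.sqrt (2 ^ k) = ((2:ℝ) ^ k : ℝ) := by
    exact_mod_cast Real.mul_self_sqrt (by positivity : (0:ℝ) ≤ 2 ^ k)
  rw [integral_psiDkmHat_mul_conj, integral_PhiD_mul_conj_self hD, map_mul, Complex.conj_ofReal,
    mul_mul_mul_comm, hs, exp_mul_conj_exp]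
  simp only [indicator, mem_ofPred_eq, mul_ite, mul_one, mul_zero]
  rw [show -m - -m' = m' - m by ring]

theorem ne_zero_and_abs_le_half_ae_eq_Ioc :
    ({u : ℝ | u ≠ 0 ∧ |u| ≤ 1 / 2} : Set ℝ) =ᵐ[volume] Ioc (-(1 / 2) : ℝ) (-(1 / 2) + 1) := by
  have h : ∀ᵐ u : ℝ, u ≠ 0 ∧ u ≠ -(1 / 2) := by
    filter_upwards [compl_mem_ae_iff.2 (measure_singleton (μ := volume) (0 : ℝ)),
      compl_mem_ae_iff.2 (measure_singleton (μ := volume) (-(1 / 2) : ℝ))] with u h1 h2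
    exact ⟨h1, h2⟩
  filter_upwards [h] with u hu
  refine propext ⟨fun h => ?_, fun h => ⟨hu.1, ?_⟩⟩
  · have := abs_le.1 h.2
    exact ⟨lt_of_le_of_ne this.1 hu.2.symm, by linarith [this.2]⟩
  · exact abs_le.2 ⟨h.1.le, by linarith [h.2]⟩

theorem measurableSet_ne_zero_and_abs_le_half : MeasurableSet {u : ℝ | u ≠ 0 ∧ |u| ≤ 1 / 2} :=
  (measurableSet_singleton 0).compl.inter (measurableSet_le measurable_norm measurable_const)

theorem integral_integral_psiDkmHat (hD : BijOn D univ {n : ℕ | 1 ≤ n}) (k m k' m' : ℤ) :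
    ∫ s, ∫ y, psiDkmHat D k m (s, y) * (starRingEnd ℂ) (psiDkmHat D k' m' (s, y)) =
      if k = k' ∧ m = m' then 1 else 0 := by
  by_cases hk : k = k'
  · subst hk
    simp only [integral_psiDkmHat_mul_conj_of_eq hD]
    have ha : (0:ℝ) < 2 ^ k := by positivity
    rw [integral_const_mul, Measure.integral_comp_mul_left, abs_of_pos (inv_pos.2 ha),
      integral_indicator measurableSet_ne_zero_and_abs_le_half,
      setIntegral_congr_set ne_zero_and_abs_le_half_ae_eq_Ioc,
      integral_exp_two_pi_int, Complex.real_smul, ← mul_assoc, ← Complex.ofReal_mul,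
      mul_inv_cancel₀ ha.ne']
    simp [sub_eq_zero, eq_comm]
  · simp [integral_psiDkmHat_mul_conj, integral_PhiD_mul_conj_of_ne hD hk, hk]

theorem memLp_psiDkmHat (hD : BijOn D univ {n : ℕ | 1 ≤ n}) (k m : ℤ) :
    MemLp (psiDkmHat D k m) 2 := by
  have hm := measurable_psiDkmHat D k m
  have hsec : ∀ s, MemLp (fun y => psiDkmHat D k m (s, y)) 2 := fun s =>
    (memLp_PhiD hD (2 ^ k * s) 2).const_mul ((Real.sqrt ((2:ℝ) ^ k) : ℂ) *
      Complex.exp (2 * Real.pi * Complex.I * (-m : ℤ) * ((2:ℝ) ^ k * s : ℝ)))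
  rw [memLp_two_iff_integrable_sq_norm hm.aestronglyMeasurable, Measure.volume_eq_prod,
    integrable_prod_iff (by fun_prop)]
  refine ⟨.of_forall fun s =>
    (memLp_two_iff_integrable_sq_norm (hsec s).1).1 (hsec s), ?_⟩
  have hint : Integrable fun s =>
      ∫ y, psiDkmHat D k m (s, y) * (starRingEnd ℂ) (psiDkmHat D k m (s, y)) := by
    refine Integrable.of_integral_ne_zero ?_
    rw [integral_integral_psiDkmHat hD]
    simp
  refine hint.norm.congr (.of_forall fun s => ?_)
  simp only [Complex.mul_conj, Complex.normSq_eq_norm_sq, integral_complex_ofReal, norm_pow,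
    norm_norm, Complex.norm_real]
  exact Real.norm_of_nonneg (integral_nonneg fun y => by positivity)

/-- The functions `ψ^D_{k,m}`, `k,m ∈ ℤ`, are pairwise orthonormal in `L²(ℝ²)`. -/
theorem stmt13 (D : ℤ × ℤ → ℕ) (hD : Set.BijOn D Set.univ {n : ℕ | 1 ≤ n}) :
    ∀ k m k' m' : ℤ,
      ∫ p : ℝ × ℝ, psiDkm D k m p * (starRingEnd ℂ) (psiDkm D k' m' p) =
        if k = k' ∧ m = m' then 1 else 0 := by
  intro k m k' m'
  have h1 : ∀ k m y, Integrable fun s => psiDkmHat D k m (s, y) := fun k m y =>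
    memLp_one_iff_integrable.1 (memLp_psiDkmHat_fst hD k m y 1)
  simp only [psiDkm_eq_fourierInv]
  rw [integral_fourierInv_fst_mul_conj (measurable_psiDkmHat D k m) (h1 k m)
    (fun y => memLp_psiDkmHat_fst hD k m y 2) (memLp_psiDkmHat hD k m)
    (measurable_psiDkmHat D k' m') (h1 k' m')
    (fun y => memLp_psiDkmHat_fst hD k' m' y 2) (memLp_psiDkmHat hD k' m')]
  exact integral_integral_psiDkmHat hD k m k' m'
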